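/- arXiv:1707.07047 — 4 statements merged into one kernel-verified Lean document; each statement's English description precedes it below -/
import Mathlib

section
/- Let (V,ω), (W,σ), (Z,τ) be symplectic vector spaces. If L ⊆ V × W is a linear canonical relation from V to W and L' ⊆ W × Z is a linear canonical relation from W to Z, then the set-theoretic composition L' ∘ L = {(v,z) : ∃ w ∈ W, (v,w) ∈ L and (w,z) ∈ L'} is a linear canonical relation from V to Z. (This is the linear-algebraic content of the paper's proposition that the composition of canonical relations, whenever smooth, is again a canonical relation: the Lagrangian condition is automatic.) -/
/-- The symplectic orthogonal `W^⊥ = {v | ∀ w ∈ W, ω v w = 0}` of a subspace. -/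
def sympOrth {V : Type*} [AddCommGroup V] [Module ℝ V]
    (ω : V →ₗ[ℝ] V →ₗ[ℝ] ℝ) (N : Submodule ℝ V) : Submodule ℝ V where
  carrier := {v | ∀ w ∈ N, ω v w = 0}
  add_mem' := by
    intro a b ha hb w hw
    simp only [map_add, LinearMap.add_apply, ha w hw, hb w hw, add_zero]
  zero_mem' := by intro w hw; simp
  smul_mem' := by
    intro c a ha w hw
    simp only [map_smul, LinearMap.smul_apply, ha w hw, smul_zero]

/-- A symplectic form: alternating and nondegenerate. -/
def IsSymplecticForm {V : Type*} [AddCommGroup V] [Module ℝ V]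
    (ω : V →ₗ[ℝ] V →ₗ[ℝ] ℝ) : Prop :=
  (∀ v, ω v v = 0) ∧ (∀ v, (∀ w, ω v w = 0) → v = 0)

/-- A subspace is Lagrangian if it equals its symplectic orthogonal. -/
def IsLagrangian {V : Type*} [AddCommGroup V] [Module ℝ V]
    (ω : V →ₗ[ℝ] V →ₗ[ℝ] ℝ) (L : Submodule ℝ V) : Prop :=
  L = sympOrth ω L

/-- A subspace is coisotropic if it contains its symplectic orthogonal. -/
def IsCoisotropic {V : Type*} [AddCommGroup V] [Module ℝ V]
    (ω : V →ₗ[ℝ] V →ₗ[ℝ] ℝ) (C : Submodule ℝ V) : Prop :=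
  sympOrth ω C ≤ C

/-- The form `Ω((v,w),(v',w')) = σ(w,w') − ω(v,v')` on `V × W`. -/
def pairForm {V W : Type*} [AddCommGroup V] [Module ℝ V] [AddCommGroup W] [Module ℝ W]
    (ω : V →ₗ[ℝ] V →ₗ[ℝ] ℝ) (σ : W →ₗ[ℝ] W →ₗ[ℝ] ℝ) :
    (V × W) →ₗ[ℝ] (V × W) →ₗ[ℝ] ℝ :=
  LinearMap.mk₂ ℝ (fun p q => σ p.2 q.2 - ω p.1 q.1)
    (by intro p p' q; simp; ring)
    (by intro c p q; simp; ring)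
    (by intro p q q'; simp; ring)
    (by intro c p q; simp; ring)

/-- A linear canonical relation from `(V,ω)` to `(W,σ)`: a subspace of `V × W`
Lagrangian for `Ω((v,w),(v',w')) = σ(w,w') − ω(v,v')`. -/
def IsLinearCanonicalRelation {V W : Type*} [AddCommGroup V] [Module ℝ V]
    [AddCommGroup W] [Module ℝ W]
    (ω : V →ₗ[ℝ] V →ₗ[ℝ] ℝ) (σ : W →ₗ[ℝ] W →ₗ[ℝ] ℝ)
    (L : Submodule ℝ (V × W)) : Prop :=
  IsLagrangian (pairForm ω σ) L

theorem mem_sympOrth {V : Type*} [AddCommGroup V] [Module ℝ V]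
    {ω : V →ₗ[ℝ] V →ₗ[ℝ] ℝ} {N : Submodule ℝ V} {v : V} :
    v ∈ sympOrth ω N ↔ ∀ w ∈ N, ω v w = 0 := Iff.rfl

theorem IsLinearCanonicalRelation.mem_iff {V W : Type*} [AddCommGroup V] [Module ℝ V]
    [AddCommGroup W] [Module ℝ W]
    {ω : V →ₗ[ℝ] V →ₗ[ℝ] ℝ} {σ : W →ₗ[ℝ] W →ₗ[ℝ] ℝ} {L : Submodule ℝ (V × W)}
    (hL : IsLinearCanonicalRelation ω σ L) {p : V × W} :
    p ∈ L ↔ ∀ q ∈ L, σ p.2 q.2 - ω p.1 q.1 = 0 :=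
  (SetLike.ext_iff.mp hL p).trans mem_sympOrth

theorem IsSymplecticForm.surjective {W : Type*} [AddCommGroup W] [Module ℝ W]
    [FiniteDimensional ℝ W] {σ : W →ₗ[ℝ] W →ₗ[ℝ] ℝ} (hσ : IsSymplecticForm σ) :
    Function.Surjective σ := by
  refine (LinearMap.injective_iff_surjective_of_finrank_eq_finrank
    (Subspace.dual_finrank_eq (K := ℝ) (V := W)).symm).mp ?_
  refine (injective_iff_map_eq_zero σ).mpr fun v hv => hσ.2 v fun w => ?_
  simp [hv]

/-- The set-theoretic composition of two linear relations, as a subspace. -/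
def relComp {V W Z : Type*} [AddCommGroup V] [Module ℝ V] [AddCommGroup W] [Module ℝ W]
    [AddCommGroup Z] [Module ℝ Z] (L : Submodule ℝ (V × W)) (L' : Submodule ℝ (W × Z)) :
    Submodule ℝ (V × Z) where
  carrier := {p | ∃ w, (p.1, w) ∈ L ∧ (w, p.2) ∈ L'}
  add_mem' := by
    rintro p q ⟨w, hw, hw'⟩ ⟨u, hu, hu'⟩
    exact ⟨w + u, L.add_mem hw hu, L'.add_mem hw' hu'⟩
  zero_mem' := ⟨0, L.zero_mem, L'.zero_mem⟩
  smul_mem' := by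
    rintro c p ⟨w, hw, hw'⟩
    refine ⟨c • w, L.smul_mem c hw, L'.smul_mem c hw'⟩

/-- A functional on `L × L'` killing all pairs with matching middle components factors through
the difference of the middle components; representing the factor by `σ` gives a point of `W`. -/
theorem exists_middle_of_mem_sympOrth_relComp {V W Z : Type*} [AddCommGroup V] [Module ℝ V]
    [AddCommGroup W] [Module ℝ W] [FiniteDimensional ℝ W] [AddCommGroup Z] [Module ℝ Z]
    {ω : V →ₗ[ℝ] V →ₗ[ℝ] ℝ} {σ : W →ₗ[ℝ] W →ₗ[ℝ] ℝ} {τ : Z →ₗ[ℝ] Z →ₗ[ℝ] ℝ}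
    (hσ : IsSymplecticForm σ) {L : Submodule ℝ (V × W)} {L' : Submodule ℝ (W × Z)} {p : V × Z}
    (hp : p ∈ sympOrth (pairForm ω τ) (relComp L L')) :
    ∃ w, ∀ q ∈ L, ∀ r ∈ L', σ w (q.2 - r.1) = ω p.1 q.1 - τ p.2 r.2 := by
  let T : (L × L') →ₗ[ℝ] W :=
    (LinearMap.snd ℝ V W ∘ₗ L.subtype).coprod (-(LinearMap.fst ℝ W Z ∘ₗ L'.subtype))
  let f : Module.Dual ℝ (L × L') :=
    (ω p.1 ∘ₗ LinearMap.fst ℝ V W ∘ₗ L.subtype).coprod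
      (-(τ p.2 ∘ₗ LinearMap.snd ℝ W Z ∘ₗ L'.subtype))
  have hf : f ∈ LinearMap.range T.dualMap := by
    rw [LinearMap.range_dualMap_eq_dualAnnihilator_ker, Submodule.mem_dualAnnihilator]
    rintro ⟨⟨⟨a, b⟩, hq⟩, ⟨⟨c, d⟩, hr⟩⟩ hk
    have hbc : b = c := by
      simpa [T, ← sub_eq_add_neg, sub_eq_zero] using hk
    subst hbc
    have h : τ p.2 d - ω p.1 a = 0 := mem_sympOrth.mp hp (a, d) ⟨b, hq, hr⟩
    simp only [f, LinearMap.coprod_apply, LinearMap.neg_apply, LinearMap.comp_apply,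
      Submodule.subtype_apply, LinearMap.fst_apply, LinearMap.snd_apply]
    linarith
  obtain ⟨g, hg⟩ := hf
  obtain ⟨w, rfl⟩ := hσ.surjective g
  refine ⟨w, fun q hq r hr => ?_⟩
  simpa [T, f, sub_eq_add_neg] using LinearMap.congr_fun hg (⟨q, hq⟩, ⟨r, hr⟩)

/-- the set-theoretic composition of two linear canonical relations
is again a linear canonical relation. -/
theorem composition_of_linear_canonical_relations
    {V W Z : Type*} [AddCommGroup V] [Module ℝ V] [FiniteDimensional ℝ V]
    [AddCommGroup W] [Module ℝ W] [FiniteDimensional ℝ W]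
    [AddCommGroup Z] [Module ℝ Z] [FiniteDimensional ℝ Z]
    (ω : V →ₗ[ℝ] V →ₗ[ℝ] ℝ) (σ : W →ₗ[ℝ] W →ₗ[ℝ] ℝ) (τ : Z →ₗ[ℝ] Z →ₗ[ℝ] ℝ)
    (hω : IsSymplecticForm ω) (hσ : IsSymplecticForm σ) (hτ : IsSymplecticForm τ)
    (L : Submodule ℝ (V × W)) (L' : Submodule ℝ (W × Z))
    (hL : IsLinearCanonicalRelation ω σ L) (hL' : IsLinearCanonicalRelation σ τ L') :
    ∃ Lc : Submodule ℝ (V × Z),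
      (Lc : Set (V × Z)) = {p | ∃ w, (p.1, w) ∈ L ∧ (w, p.2) ∈ L'} ∧
      IsLinearCanonicalRelation ω τ Lc := by
  refine ⟨relComp L L', rfl, le_antisymm ?_ ?_⟩
  · rintro p ⟨w, hw, hw'⟩ q ⟨u, hu, hu'⟩
    have h₁ := hL.mem_iff.mp hw _ hu
    have h₂ := hL'.mem_iff.mp hw' _ hu'
    change τ p.2 q.2 - ω p.1 q.1 = 0
    dsimp only at h₁ h₂
    linarith
  · intro p hp
    obtain ⟨w, hw⟩ := exists_middle_of_mem_sympOrth_relComp hσ hp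
    refine ⟨w, hL.mem_iff.mpr fun q hq => ?_, hL'.mem_iff.mpr fun r hr => ?_⟩
    · simpa [sub_eq_zero] using hw q hq 0 L'.zero_mem
    · have h := hw 0 L.zero_mem r hr
      rw [sub_eq_zero]
      simpa using h.symm
end

section
/- Let f : V → W be a linear map between finite-dimensional real vector spaces. Then Λ_f ∘ (Λ_f)ᵗ equals the diagonal (identity relation) of W × W* if and only if f is surjective. (Linear/relational version of the paper's proposition that the cotangent lift of f is a reduction if and only if f is a surmersion.) -/
/-- Set-theoretic composition of relations: `RelComp R R' = R' ∘ R`. -/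
def RelComp {α β γ : Type*} (R : Set (α × β)) (R' : Set (β × γ)) : Set (α × γ) :=
  {p | ∃ b, (p.1, b) ∈ R ∧ (b, p.2) ∈ R'}

/-- The transpose relation `Rᵗ = {(b,a) : (a,b) ∈ R}`. -/
def RelTranspose {α β : Type*} (R : Set (α × β)) : Set (β × α) :=
  {p | (p.2, p.1) ∈ R}
/-- The cotangent lift `Λ_f = {((v, f*ξ), (f v, ξ))}` as a set-theoretic relation. -/
def cotLiftSet {V W : Type*} [AddCommGroup V] [Module ℝ V] [AddCommGroup W] [Module ℝ W]
    (f : V →ₗ[ℝ] W) :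
    Set ((V × Module.Dual ℝ V) × (W × Module.Dual ℝ W)) :=
  {p | ∃ v ξ, p = ((v, f.dualMap ξ), (f v, ξ))}

/-- `Λ_f ∘ (Λ_f)ᵗ` is the identity relation on `W × W*` iff `f` is
surjective. -/
theorem cotLift_comp_transpose_eq_id_iff_surjective
    {V W : Type*} [AddCommGroup V] [Module ℝ V] [FiniteDimensional ℝ V]
    [AddCommGroup W] [Module ℝ W] [FiniteDimensional ℝ W]
    (f : V →ₗ[ℝ] W) :
    RelComp (RelTranspose (cotLiftSet f)) (cotLiftSet f)
      = Set.diagonal (W × Module.Dual ℝ W) ↔ Function.Surjective f := by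
  constructor
  · intro h w
    have hw : ((w, 0), (w, 0)) ∈ Set.diagonal (W × Module.Dual ℝ W) := rfl
    rw [← h] at hw
    obtain ⟨_, ⟨v, ξ, hv⟩, _⟩ := hw
    exact ⟨v, (congrArg (fun p => p.2.1) hv).symm⟩
  · intro hf
    ext ⟨⟨w, η⟩, ⟨w', η'⟩⟩
    constructor
    · rintro ⟨_, ⟨v, ξ, h⟩, ⟨v', ξ', h'⟩⟩
      simp only [Prod.mk.injEq] at h h'
      obtain ⟨rfl, rfl, rfl⟩ := h
      obtain ⟨h, rfl, rfl⟩ := h'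
      simp only [Prod.mk.injEq] at h
      obtain ⟨rfl, h⟩ := h
      rw [LinearMap.dualMap_injective_of_surjective hf h]
      rfl
    · intro h
      simp only [Set.mem_diagonal_iff, Prod.mk.injEq] at h
      obtain ⟨rfl, rfl⟩ := h
      obtain ⟨v, rfl⟩ := hf w
      exact ⟨(v, f.dualMap η), ⟨v, η, rfl⟩, ⟨v, η, rfl⟩⟩
end

section
/- Let f : V → W be a linear map between finite-dimensional real vector spaces. Then (Λ_f)ᵗ ∘ Λ_f equals the diagonal (identity relation) of V × V* if and only if f is injective. (Linear/relational version of the paper's proposition that the cotangent lift of f is a coreduction if and only if f is a cosurmersion.) -/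
/-- `(Λ_f)ᵗ ∘ Λ_f` is the identity relation on `V × V*` iff `f` is
injective. -/
theorem transpose_comp_cotLift_eq_id_iff_injective
    {V W : Type*} [AddCommGroup V] [Module ℝ V] [FiniteDimensional ℝ V]
    [AddCommGroup W] [Module ℝ W] [FiniteDimensional ℝ W]
    (f : V →ₗ[ℝ] W) :
    RelComp (cotLiftSet f) (RelTranspose (cotLiftSet f))
      = Set.diagonal (V × Module.Dual ℝ V) ↔ Function.Injective f := by
  constructor
  · intro h v v' hv
    have hmem : ((v, f.dualMap 0), (v', f.dualMap 0)) ∈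
        RelComp (cotLiftSet f) (RelTranspose (cotLiftSet f)) :=
      ⟨(f v, 0), ⟨v, 0, rfl⟩, ⟨v', 0, by rw [hv]⟩⟩
    rw [h] at hmem
    exact congrArg Prod.fst hmem
  · intro hf
    ext ⟨⟨v, η⟩, ⟨v', η'⟩⟩
    constructor
    · rintro ⟨⟨w, ζ⟩, ⟨x, ξ, hx⟩, ⟨y, ξ', hy⟩⟩
      simp only [Prod.mk.injEq] at hx hy
      obtain ⟨⟨rfl, rfl⟩, rfl, rfl⟩ := hx
      obtain ⟨⟨rfl, rfl⟩, hw, rfl⟩ := hy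
      rw [Set.mem_diagonal_iff, hf hw]
    · intro h
      simp only [Set.mem_diagonal_iff, Prod.mk.injEq] at h
      obtain ⟨rfl, rfl⟩ := h
      obtain ⟨ξ, rfl⟩ := LinearMap.dualMap_surjective_of_injective hf η
      exact ⟨(f v, ξ), ⟨v, ξ, rfl⟩, ⟨v, ξ, rfl⟩⟩
end

section
/- Let (V,ω) be a symplectic vector space, C ⊆ V a coisotropic subspace with reduced symplectic vector space (C/C^⊥, ω̄), and L ⊆ V a Lagrangian subspace. Then the image of L ∩ C under the quotient map C → C/C^⊥ is a Lagrangian subspace of (C/C^⊥, ω̄). (Linear version of the standard method, used in the paper's discussion of morphisms, of producing Lagrangian submanifolds of symplectic quotients from Lagrangian submanifolds of the ambient space.) -/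
theorem sympOrth_eq_orthogonal {V : Type*} [AddCommGroup V] [Module ℝ V]
    {ω : V →ₗ[ℝ] V →ₗ[ℝ] ℝ} (hω : IsSymplecticForm ω) (N : Submodule ℝ V) :
    sympOrth ω N = LinearMap.BilinForm.orthogonal ω N := by
  have hω' : LinearMap.IsAlt ω := hω.1
  ext v
  exact forall₂_congr fun w _ => hω'.isRefl.eq_iff

theorem sympOrth_sympOrth {V : Type*} [AddCommGroup V] [Module ℝ V] [FiniteDimensional ℝ V]
    {ω : V →ₗ[ℝ] V →ₗ[ℝ] ℝ} (hω : IsSymplecticForm ω) (N : Submodule ℝ V) :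
    sympOrth ω (sympOrth ω N) = N := by
  have hω' : LinearMap.IsAlt ω := hω.1
  have hnd : LinearMap.BilinForm.Nondegenerate ω :=
    hω'.isRefl.nondegenerate_iff_separatingLeft.2 hω.2
  rw [sympOrth_eq_orthogonal hω, sympOrth_eq_orthogonal hω]
  exact LinearMap.BilinForm.orthogonal_orthogonal hnd hω'.isRefl N

theorem sympOrth_sup {V : Type*} [AddCommGroup V] [Module ℝ V]
    (ω : V →ₗ[ℝ] V →ₗ[ℝ] ℝ) (M N : Submodule ℝ V) :
    sympOrth ω (M ⊔ N) = sympOrth ω M ⊓ sympOrth ω N := by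
  ext v
  constructor
  · intro h
    exact ⟨fun w hw => h w (Submodule.mem_sup_left hw),
      fun w hw => h w (Submodule.mem_sup_right hw)⟩
  · rintro ⟨hM, hN⟩ w hw
    obtain ⟨a, ha, b, hb, rfl⟩ := Submodule.mem_sup.1 hw
    rw [map_add, hM a ha, hN b hb, add_zero]

theorem sympOrth_inf {V : Type*} [AddCommGroup V] [Module ℝ V] [FiniteDimensional ℝ V]
    {ω : V →ₗ[ℝ] V →ₗ[ℝ] ℝ} (hω : IsSymplecticForm ω) (M N : Submodule ℝ V) :
    sympOrth ω (M ⊓ N) = sympOrth ω M ⊔ sympOrth ω N := by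
  rw [← sympOrth_sympOrth hω (sympOrth ω M ⊔ sympOrth ω N), sympOrth_sup,
    sympOrth_sympOrth hω, sympOrth_sympOrth hω]

/-- the image of `L ∩ C` in the symplectic reduction `C/C^⊥` of a
coisotropic subspace `C` is Lagrangian, for any Lagrangian subspace `L ⊆ V`. -/
theorem image_of_lagrangian_in_reduction_isLagrangian
    {V : Type*} [AddCommGroup V] [Module ℝ V] [FiniteDimensional ℝ V]
    (ω : V →ₗ[ℝ] V →ₗ[ℝ] ℝ) (hω : IsSymplecticForm ω)
    (C : Submodule ℝ V) (hC : IsCoisotropic ω C)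
    (ωbar : (C ⧸ (sympOrth ω C).comap C.subtype) →ₗ[ℝ]
        (C ⧸ (sympOrth ω C).comap C.subtype) →ₗ[ℝ] ℝ)
    (hred : ∀ x y : C, ωbar (Submodule.Quotient.mk x) (Submodule.Quotient.mk y) = ω x y)
    (L : Submodule ℝ V) (hL : IsLagrangian ω L) :
    IsLagrangian ωbar
      (Submodule.map ((sympOrth ω C).comap C.subtype).mkQ
        ((L ⊓ C).comap C.subtype)) := by
  ext q
  obtain ⟨x, rfl⟩ := Submodule.Quotient.mk_surjective _ q
  constructor
  · rintro ⟨l, ⟨hl, -⟩, hlx⟩ _ ⟨m, ⟨hm, -⟩, rfl⟩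
    rw [← hlx, Submodule.mkQ_apply, Submodule.mkQ_apply, hred]
    exact (hL ▸ hl : (l : V) ∈ sympOrth ω L) m hm
  · intro h
    have hx : (x : V) ∈ sympOrth ω (L ⊓ C) := fun w hw => by
      rw [← hred x ⟨w, hw.2⟩]
      exact h _ ⟨⟨w, hw.2⟩, hw, rfl⟩
    rw [sympOrth_inf hω, ← hL] at hx
    obtain ⟨l, hl, c, hc, hlc⟩ := Submodule.mem_sup.1 hx
    have hlC : l ∈ C := by
      rw [eq_sub_of_add_eq hlc]
      exact C.sub_mem x.2 (hC hc)
    refine ⟨⟨l, hlC⟩, ⟨hl, hlC⟩, ((Submodule.Quotient.eq _).2 ?_).symm⟩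
    change (x : V) - l ∈ sympOrth ω C
    rwa [← hlc, add_sub_cancel_left]
end
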